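/- Fix integers m, n ≥ 1 and consider the right operators B^R_{1/2}, B^R_{−1/2} on 𝒱^ȷ_{m|n,n}. Then for every A ∈ Ξ^{ȷ,0}_{m|n,n}: (1) t^{(A)} B^R_{−1/2} = 0; (2) t^{(A)} B^R_{1/2} B^R_{1/2} = 0; (3) the composite C sending x to (x B^R_{1/2}) B^R_{−1/2} maps 𝒱^{ȷ,0}_{m|n,n} into itself, with C(t^{(A_λ)}) = t^{(A_{λ·s_0})} + q^{sgn(λ_1)} t^{(A_λ)} when λ_1 ≠ 0 (where λ·s_0 = (−λ_1, λ_2,…,λ_n)) and C(t^{(A_λ)}) = (q + q^{−1}) t^{(A_λ)} when λ_1 = 0; (4) by (1) and (2), on 𝒱^{ȷ,0}_{m|n,n} the operator Σ_{t,l≥0} (−1)^{t+l} q^{−(t−l)(t−l+1)/2 − t − l} B^{(t)}_{−1/2} B^{(t+l)}_{1/2} B^{(l)}_{−1/2} (applied on the right, with divided powers B^{(k)} = B^k/[k]!) has only finitely many nonzero terms and equals T_0 := id − q^{−1} C; (5) (−q)·T_0(Λ^ȷ(v_λ)) = Λ^ȷ(σ_0(v_λ)) for every λ ∈ {−m,…,m}^n;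 (6) (T_0 + q^{−2}·id)(T_0 − id) = 0 on 𝒱^{ȷ,0}_{m|n,n}. -/

import Mathlib

open scoped BigOperators Classical

noncomputable section

/-- The base field `ℚ(q)`. -/
abbrev K : Type := RatFunc ℚ

/-- The indeterminate `q`. -/
def q : K := RatFunc.X

/-- The quantum integer `[r] = (q^r - q^{-r})/(q - q^{-1})`. -/
def qint (r : ℤ) : K := (q ^ r - q ^ (-r)) / (q - q⁻¹)

/-- The quantum factorial `[r]!`. -/
def qfac : ℕ → K
  | 0 => 1
  | n+1 => qfac n * qint (n+1)

/-- The index set `𝕀_N = {-(N-1)/2, -(N-3)/2, …, (N-1)/2}` as a finite set of rationals. -/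
def II (N : ℕ) : Finset ℚ := (Finset.range N).image (fun k : ℕ => (k : ℚ) - ((N : ℚ) - 1) / 2)

theorem II_neg {N : ℕ} {a : ℚ} (h : a ∈ II N) : -a ∈ II N := by
  obtain ⟨k, hk, hv⟩ := Finset.mem_image.mp h
  rw [Finset.mem_range] at hk
  refine Finset.mem_image.mpr ⟨N - 1 - k, Finset.mem_range.mpr (by omega), ?_⟩
  have h1 : ((N - 1 - k : ℕ) : ℚ) = (N : ℚ) - 1 - (k : ℚ) := by
    have h2 : (N : ℚ) = ((N - 1 - k : ℕ) : ℚ) + (k : ℚ) + 1 := by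
      exact_mod_cast congrArg (Nat.cast : ℕ → ℚ) (by omega : N = (N - 1 - k) + k + 1)
    linarith
  rw [h1, ← hv]; ring

/-- Matrices with rational row/column labels and natural number entries. -/
abbrev Mat : Type := ℚ → ℚ → ℕ

/-- The θ-elementary matrix `E^θ_{r,c} = E_{r,c} + E_{-r,-c}`. -/
def chiM (r c : ℚ) : Mat := fun x y =>
  (if x = r ∧ y = c then 1 else 0) + (if x = -r ∧ y = -c then 1 else 0)

/-- `A + E^θ_{p,j} - E^θ_{p',j'}` (truncated ℕ-subtraction; only used where the
corresponding q-integer coefficient vanishes otherwise). -/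
def matMove (A : Mat) (p j p' j' : ℚ) : Mat := fun x y => A x y + chiM p j x y - chiM p' j' x y

/-- Free `ℚ(q)`-vector space on the set of matrices `P`. -/
abbrev FM (P : Set Mat) : Type := {A : Mat // A ∈ P} →₀ K

/-- Basis vector `t^{(A)}` (zero if `A ∉ P`). -/
def tP (P : Set Mat) (A : Mat) : FM P := if h : A ∈ P then Finsupp.single ⟨A, h⟩ 1 else 0

/-- Linear operator on `FM P` defined by its values on basis vectors. -/
def opOf {P : Set Mat} (f : Mat → FM P) : FM P →ₗ[K] FM P :=
  Finsupp.lift (FM P) K {A : Mat // A ∈ P} fun A => f A.1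

/-- The set `Ξ^j_{m|n,d}`: matrices supported on `{-m,…,m} × {-n,…,n}`, centro-symmetric,
with total entry sum `2d+1`.  (Note `𝕀_{2m+1} = {-m,…,m}`.) -/
def Xij (m n d : ℕ) : Set Mat :=
  {A | (∀ i j, A i j ≠ 0 → i ∈ II (2*m+1) ∧ j ∈ II (2*n+1)) ∧
       (∀ i j, A i j = A (-i) (-j)) ∧
       ∑ i ∈ II (2*m+1), ∑ j ∈ II (2*n+1), A i j = 2*d+1}

/-- Left operator `B^L_i` (j-case), for half-integers `i ∈ {1/2,…,m-1/2}`. -/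
def BLj (n : ℕ) (P : Set Mat) (i : ℚ) : FM P →ₗ[K] FM P :=
  opOf fun A =>
    (∑ j ∈ (II (2*n+1)).filter (fun j => j ≤ 0),
      if (if i = 1/2 ∧ j = 0 then 1 else 0) < A (i-1/2) j then
        (q ^ ((∑ k ∈ (II (2*n+1)).filter (fun k => j ≤ k), ((A (i+1/2) k : ℤ) - (A (i-1/2) k : ℤ)))
              + 1 + (if i = 1/2 then 1 else 0))
          * qint ((A (i-1/2) j : ℤ) - (if i = 1/2 ∧ j = 0 then 1 else 0)))
          • tP P (matMove A (i+1/2) j (i-1/2) j)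
      else 0)
    + (∑ j ∈ (II (2*n+1)).filter (fun j => 0 < j),
        (q ^ ((∑ k ∈ (II (2*n+1)).filter (fun k => j ≤ k), ((A (i+1/2) k : ℤ) - (A (i-1/2) k : ℤ))) + 1)
          * qint (A (i-1/2) j)) • tP P (matMove A (i+1/2) j (i-1/2) j))

/-- Left operator `B^L_{-i}` (j-case), for half-integers `i ∈ {1/2,…,m-1/2}`. -/
def BLjn (n : ℕ) (P : Set Mat) (i : ℚ) : FM P →ₗ[K] FM P :=
  opOf fun A => ∑ j ∈ II (2*n+1),
    (q ^ ((∑ k ∈ (II (2*n+1)).filter (fun k => k ≤ j), ((A (i-1/2) k : ℤ) - (A (i+1/2) k : ℤ))) + 1)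
      * qint (A (i+1/2) j)) • tP P (matMove A (i-1/2) j (i+1/2) j)

/-- Left Cartan operator `(d^L_0)^e`, `e = ±1` (j-case). -/
def dL0j (n : ℕ) (P : Set Mat) (e : ℤ) : FM P →ₗ[K] FM P :=
  opOf fun A => (q ^ (e * (((∑ j ∈ II (2*n+1), (A 0 j : ℤ)) - 1) / 2))) • tP P A

/-- Left Cartan operator `(d^L_r)^e`, `r ∈ {1,…,m}`, `e = ±1` (j-case). -/
def dLj (n : ℕ) (P : Set Mat) (r : ℚ) (e : ℤ) : FM P →ₗ[K] FM P :=
  opOf fun A => (q ^ (e * ∑ j ∈ II (2*n+1), (A r j : ℤ))) • tP P A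

/-- Right operator `B^R_i` (j-case), for half-integers `i ∈ {1/2,…,n-1/2}`. -/
def BRj (m : ℕ) (P : Set Mat) (i : ℚ) : FM P →ₗ[K] FM P :=
  opOf fun A => ∑ j ∈ II (2*m+1),
    (q ^ (∑ k ∈ (II (2*m+1)).filter (fun k => j < k), ((A k (i+1/2) : ℤ) - (A k (i-1/2) : ℤ)))
      * qint (A j (i+1/2))) • tP P (matMove A j (i-1/2) j (i+1/2))

/-- Right operator `B^R_{-i}` (j-case), for half-integers `i ∈ {1/2,…,n-1/2}`. -/
def BRjn (m : ℕ) (P : Set Mat) (i : ℚ) : FM P →ₗ[K] FM P :=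
  opOf fun A =>
    (∑ j ∈ (II (2*m+1)).filter (fun j => j ≤ 0),
      if (if i = 1/2 ∧ j = 0 then 1 else 0) < A j (i-1/2) then
        (q ^ (∑ k ∈ (II (2*m+1)).filter (fun k => k < j), ((A k (i-1/2) : ℤ) - (A k (i+1/2) : ℤ)))
          * qint ((A j (i-1/2) : ℤ) - (if i = 1/2 ∧ j = 0 then 1 else 0)))
          • tP P (matMove A j (i+1/2) j (i-1/2))
      else 0)
    + (∑ j ∈ (II (2*m+1)).filter (fun j => 0 < j),
        (q ^ ((∑ k ∈ (II (2*m+1)).filter (fun k => k < j), ((A k (i-1/2) : ℤ) - (A k (i+1/2) : ℤ)))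
              - (if i = 1/2 then 1 else 0))
          * qint (A j (i-1/2))) • tP P (matMove A j (i+1/2) j (i-1/2)))

/-- Right Cartan operator `(d^R_r)^e`, `r ∈ {1,…,n}`, `e = ±1` (j-case). -/
def dRj (m : ℕ) (P : Set Mat) (r : ℚ) (e : ℤ) : FM P →ₗ[K] FM P :=
  opOf fun A => (q ^ (e * ∑ k ∈ II (2*m+1), (A k r : ℤ))) • tP P A

/-- Right Cartan operator `(d^R_0)^e`, `e = ±1` (j-case). -/
def dR0j (m : ℕ) (P : Set Mat) (e : ℤ) : FM P →ₗ[K] FM P :=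
  opOf fun A => (q ^ (e * (((∑ k ∈ II (2*m+1), (A k 0 : ℤ)) - 1) / 2))) • tP P A

/-- Basis index of `V`: elements of `𝕀_M`. -/
def SubI (M : ℕ) : Type := {a : ℚ // a ∈ II M}

/-- `V^{⊗n}`: free `ℚ(q)`-vector space on `n`-tuples from `𝕀_M`. -/
abbrev TV (n M : ℕ) : Type := (Fin n → SubI M) →₀ K

/-- Basis vector `v_λ`. -/
def tT {n M : ℕ} (l : Fin n → SubI M) : TV n M := Finsupp.single l 1

/-- A "single-target" operator on `V`: `v_a ↦ c a • v_{t a}`. -/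
structure SOp where
  t : ℚ → ℚ
  c : ℚ → K

def SOp.id' : SOp := ⟨fun a => a, fun _ => 1⟩
/-- Composite `O ∘ P`. -/
def SOp.comp (O P : SOp) : SOp := ⟨fun a => O.t (P.t a), fun a => P.c a * O.c (P.t a)⟩
/-- `E_i v_a = δ(a = i+1/2) v_{a-1}`. -/
def Eop (i : ℚ) : SOp := ⟨fun a => a - 1, fun a => if a = i + 1/2 then 1 else 0⟩
/-- `F_i v_a = δ(a = i-1/2) v_{a+1}`. -/
def Fop (i : ℚ) : SOp := ⟨fun a => a + 1, fun a => if a = i - 1/2 then 1 else 0⟩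
/-- A diagonal operator `v_a ↦ q^{f a} v_a`. -/
def diagOp (f : ℚ → ℤ) : SOp := ⟨fun a => a, fun a => q ^ f a⟩
/-- `K_i^{-1}` (diagonal). -/
def Kinv (i : ℚ) : SOp := diagOp fun a => (if a = i+1/2 then 1 else 0) - (if a = i-1/2 then 1 else 0)
/-- `K_i` (diagonal). -/
def Kpos (i : ℚ) : SOp := diagOp fun a => (if a = i-1/2 then 1 else 0) - (if a = i+1/2 then 1 else 0)
/-- `k_i^{-1} = K_i^{-1} K_{-i}`. -/
def kinv (i : ℚ) : SOp := (Kinv i).comp (Kpos (-i))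
/-- `k_i = K_i K_{-i}^{-1}`. -/
def kpos (i : ℚ) : SOp := (Kpos i).comp (Kinv (-i))
/-- `(D_r D_{-r})^e` (diagonal), `e = ±1`. -/
def DDop (r : ℚ) (e : ℤ) : SOp := diagOp fun a => e * ((if a = r then 1 else 0) + (if a = -r then 1 else 0))
/-- `D_0^e` (diagonal), `e = ±1`. -/
def D0op (e : ℤ) : SOp := diagOp fun a => e * (if a = 0 then 1 else 0)

/-- Tensor product `ops 0 ⊗ ops 1 ⊗ ⋯ ⊗ ops (n-1)` of single-target operators on `V^{⊗n}`. -/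
def tensorOp {n M : ℕ} (ops : Fin n → SOp) : TV n M →ₗ[K] TV n M :=
  Finsupp.lift (TV n M) K (Fin n → SubI M) fun l =>
    if h : ∀ r, (ops r).t (l r).1 ∈ II M then
      Finsupp.single (fun r => ⟨(ops r).t (l r).1, h r⟩) (∏ r, (ops r).c (l r).1)
    else 0

/-- `𝓑_i` on `V^{⊗n}`, for `i ≠ 0` (ı-case) resp. `i ∈ {1/2,…,m-1/2}` (ȷ-case). -/
def calB (n M : ℕ) (i : ℚ) : TV n M →ₗ[K] TV n M :=
  (∑ r : Fin n, tensorOp fun s => if s < r then SOp.id' else if s = r then Fop i else Kinv i)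
  + (∑ r : Fin n, tensorOp fun s => if s < r then kinv i else if s = r then (Eop (-i)).comp (Kinv i) else Kinv i)

/-- `𝓑_0` on `V^{⊗n}` (ı-case). -/
def calB0 (n M : ℕ) : TV n M →ₗ[K] TV n M :=
  (∑ r : Fin n, tensorOp fun s => if s < r then SOp.id' else if s = r then Fop 0 else Kinv 0)
  + q⁻¹ • (∑ r : Fin n, tensorOp fun s => if s < r then SOp.id' else if s = r then (Eop 0).comp (Kinv 0) else Kinv 0)
  + tensorOp fun _ => Kinv 0

/-- `𝓑_{-i}` on `V^{⊗n}` (ȷ-case), for `i ∈ {1/2,…,m-1/2}`. -/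
def calBn (n M : ℕ) (i : ℚ) : TV n M →ₗ[K] TV n M :=
  (∑ r : Fin n, tensorOp fun s => if s < r then SOp.id' else if s = r then Fop (-i) else Kinv (-i))
  + (∑ r : Fin n, tensorOp fun s => if s < r then kpos i else if s = r then (Kinv (-i)).comp (Eop i) else Kinv (-i))

/-- `𝓓_r^e = ((D_r D_{-r})^e)^{⊗n}`. -/
def calD (n M : ℕ) (r : ℚ) (e : ℤ) : TV n M →ₗ[K] TV n M := tensorOp fun _ => DDop r e

/-- `𝓓_0^e = (D_0^e)^{⊗n}`. -/
def calD0 (n M : ℕ) (e : ℤ) : TV n M →ₗ[K] TV n M := tensorOp fun _ => D0op e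

/-- Negation on `𝕀_M`. -/
def negS {M : ℕ} (a : SubI M) : SubI M := ⟨-a.1, II_neg a.2⟩

/-- `λ · s` where `s` interchanges the tensor positions `a` and `b`. -/
def swapL {n M : ℕ} (a b : Fin n) (l : Fin n → SubI M) : Fin n → SubI M := l ∘ Equiv.swap a b

/-- The Hecke operator `σ` acting in tensor positions `a, b` (for `a < b` adjacent). -/
def sigmaI {n M : ℕ} (a b : Fin n) : TV n M →ₗ[K] TV n M :=
  Finsupp.lift (TV n M) K (Fin n → SubI M) fun l =>
    if (l a).1 < (l b).1 then tT (swapL a b l)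
    else if (l a).1 = (l b).1 then q⁻¹ • tT l
    else tT (swapL a b l) + (q⁻¹ - q) • tT l

/-- The Hecke operator `σ_0`. -/
def sigma0 {n M : ℕ} (hn : 0 < n) : TV n M →ₗ[K] TV n M :=
  Finsupp.lift (TV n M) K (Fin n → SubI M) fun l =>
    if 0 < (l ⟨0, hn⟩).1 then tT (Function.update l ⟨0, hn⟩ (negS (l ⟨0, hn⟩)))
    else if (l ⟨0, hn⟩).1 = 0 then q⁻¹ • tT l
    else tT (Function.update l ⟨0, hn⟩ (negS (l ⟨0, hn⟩))) + (q⁻¹ - q) • tT l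

/-- `σ_i`, `0 ≤ i ≤ n-1` (for `i ≥ 1` it acts on the 1-based entries `λ_i, λ_{i+1}`). -/
def sigmaB {n M : ℕ} (hn : 0 < n) (i : ℕ) (hi : i < n) : TV n M →ₗ[K] TV n M :=
  if i = 0 then sigma0 hn else sigmaI ⟨i - 1, by omega⟩ ⟨i, hi⟩

/-- The subset `Ξ^{j,0}_{m|n,n}`. -/
def Xi0j (m n : ℕ) : Set Mat :=
  {A | A ∈ Xij m n n ∧ A 0 0 = 1 ∧
       ∀ j ∈ (II (2*n+1)).filter (fun j => 0 < j), ∑ i ∈ II (2*m+1), A i j = 1}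

/-- The ı-weight `ρ̄` subspace `𝒱^{j,0}_{m|n,n}`. -/
def V0j (m n : ℕ) : Submodule K (FM (Xij m n n)) :=
  Submodule.span K {v | ∃ A ∈ Xi0j m n, v = tP (Xij m n n) A}

/-- The 0-1 matrix `A_λ` (j-case): column `j` is `e_{λ_j}`, column `-j` is `e_{-λ_j}`
(`j = 1,…,n`; here `j : Fin n` is 0-based, so column `j + 1`), and column `0` is `e_0`. -/
def Aj {n : ℕ} (l : Fin n → ℚ) : Mat := fun x y =>
  (if x = 0 ∧ y = 0 then 1 else 0)
  + ∑ j : Fin n, ((if y = (j : ℚ) + 1 ∧ x = l j then 1 else 0)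
                + (if y = -((j : ℚ) + 1) ∧ x = -(l j) then 1 else 0))

/-- The linear map `Λ^j : V^{⊗n} → 𝒱^j_{m|n,n}`, `v_λ ↦ t^{(A_λ)}`. -/
def Lamj (m n : ℕ) : TV n (2*m+1) →ₗ[K] FM (Xij m n n) :=
  Finsupp.lift (FM (Xij m n n)) K (Fin n → SubI (2*m+1)) fun l =>
    tP (Xij m n n) (Aj fun r => (l r).1)

/-- The product `∏_{r=1}^{p} (B² - [2r-2]²·id)` in the endomorphism algebra. -/
def prodFac {M : Type} [AddCommGroup M] [Module K M] (B : Module.End K M) : ℕ → Module.End K M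
  | 0 => 1
  | p+1 => prodFac B p * (B * B - ((qint (2*p))^2) • (1 : Module.End K M))

/-- The even ı-divided power `B^{(2p)}_{ev} = (1/[2p]!) ∏_{r=1}^{p} (B² - [2r-2]²·id)`. -/
def BdivEv {M : Type} [AddCommGroup M] [Module K M] (B : Module.End K M) (p : ℕ) : Module.End K M :=
  (qfac (2*p))⁻¹ • prodFac B p

/-- The right operator `B^R_{1/2}` on `𝒱^ȷ_{m|n,n}` as an endomorphism. -/
def BposE (m n : ℕ) : Module.End K (FM (Xij m n n)) := BRj m (Xij m n n) (1/2)

/-- The right operator `B^R_{-1/2}` on `𝒱^ȷ_{m|n,n}` as an endomorphism. -/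
def BnegE (m n : ℕ) : Module.End K (FM (Xij m n n)) := BRjn m (Xij m n n) (1/2)

/-- The composite `C : x ↦ (x B^R_{1/2}) B^R_{-1/2}`. -/
def Cop (m n : ℕ) : Module.End K (FM (Xij m n n)) := BnegE m n * BposE m n

/-- The operator `T_0 = id - q^{-1} C`. -/
def T0j (m n : ℕ) : Module.End K (FM (Xij m n n)) := 1 - q⁻¹ • Cop m n

/-- The right-action term `x ↦ ((x B^{(t)}_{-1/2}) B^{(t+l)}_{1/2}) B^{(l)}_{-1/2}`
with divided powers `B^{(k)} = B^k/[k]!`. -/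
def jterm (m n t l : ℕ) : Module.End K (FM (Xij m n n)) :=
  ((qfac t)⁻¹ * (qfac (t+l))⁻¹ * (qfac l)⁻¹)
    • ((BnegE m n) ^ l * (BposE m n) ^ (t+l) * (BnegE m n) ^ t)

/-- The coefficient `(-1)^{t+l} q^{-(t-l)(t-l+1)/2 - t - l}`. -/
def jcoef (t l : ℕ) : K :=
  (-1 : K) ^ (t+l) * q ^ (-(((t : ℤ) - l) * ((t : ℤ) - l + 1)) / 2 - t - l)

section Module

variable {F M : Type*} [Field F] [AddCommGroup M] [Module F M] {p : F}

theorem smul_add_smul_swap (hp : p ≠ 0) (u v : M) :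
    u + p • v + p⁻¹ • (v + p⁻¹ • u) = (p + p⁻¹) • (v + p⁻¹ • u) := by
  match_scalars <;> field_simp

theorem neg_smul_sub_inv_smul (hp : p ≠ 0) (v w : M) : (-p) • (v - p⁻¹ • w) = w - p • v := by
  rw [smul_sub, smul_smul, neg_mul, mul_inv_cancel₀ hp, neg_smul, neg_smul, one_smul]
  abel

theorem hecke_relation_of_quadratic (hp : p ≠ 0) (C : Module.End F M) {v : M}
    (h : C (C v) = (p + p⁻¹) • C v) :
    ((1 - p⁻¹ • C + p ^ (-2 : ℤ) • 1) * (1 - p⁻¹ • C - 1)) v = 0 := by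
  simp only [Module.End.mul_apply, LinearMap.add_apply, LinearMap.sub_apply, LinearMap.smul_apply,
    Module.End.one_apply, map_sub, map_smul, h]
  match_scalars <;> field_simp <;> ring

end Module

theorem mem_II_odd {m : ℕ} {x : ℚ} :
    x ∈ II (2 * m + 1) ↔ ∃ z : ℤ, -(m : ℤ) ≤ z ∧ z ≤ m ∧ x = z := by
  unfold II
  simp only [Finset.mem_image, Finset.mem_range]
  constructor
  · rintro ⟨k, hk, rfl⟩
    refine ⟨(k : ℤ) - m, by omega, by omega, ?_⟩
    push_cast; ring
  · rintro ⟨z, h1, h2, rfl⟩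
    refine ⟨(z + m).toNat, by omega, ?_⟩
    have h : (((z + m).toNat : ℤ) : ℚ) = ((z + m : ℤ) : ℚ) := by
      rw [Int.toNat_of_nonneg (by omega)]
    rw [Int.cast_natCast] at h
    rw [h]; push_cast; ring

theorem zero_mem_II (m : ℕ) : (0 : ℚ) ∈ II (2 * m + 1) :=
  mem_II_odd.mpr ⟨0, by omega, by omega, by simp⟩

theorem succ_mem_II {n : ℕ} (j : Fin n) : (j : ℚ) + 1 ∈ II (2 * n + 1) :=
  mem_II_odd.mpr ⟨(j : ℕ) + 1, by omega, by omega, by push_cast; rfl⟩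

theorem one_mem_II {n : ℕ} (hn : 1 ≤ n) : (1 : ℚ) ∈ II (2 * n + 1) :=
  mem_II_odd.mpr ⟨1, by omega, by omega, by simp⟩

theorem eq_of_mem_II {n : ℕ} {y : ℚ} (hy : y ∈ II (2 * n + 1)) :
    y = 0 ∨ ∃ k : Fin n, y = (k : ℚ) + 1 ∨ y = -((k : ℚ) + 1) := by
  obtain ⟨z, h1, h2, rfl⟩ := mem_II_odd.mp hy
  rcases lt_trichotomy z 0 with hz | rfl | hz
  · refine Or.inr ⟨⟨(-z - 1).toNat, by omega⟩, Or.inr ?_⟩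
    have h : (((-z - 1).toNat : ℤ) : ℚ) = ((-z - 1 : ℤ) : ℚ) := by
      rw [Int.toNat_of_nonneg (by omega)]
    rw [Int.cast_natCast] at h
    simp only [h]; push_cast; ring
  · simp
  · refine Or.inr ⟨⟨(z - 1).toNat, by omega⟩, Or.inl ?_⟩
    have h : (((z - 1).toNat : ℤ) : ℚ) = ((z - 1 : ℤ) : ℚ) := by
      rw [Int.toNat_of_nonneg (by omega)]
    rw [Int.cast_natCast] at h
    simp only [h]; push_cast; ring

theorem q_ne_zero : q ≠ 0 := RatFunc.X_ne_zero

theorem q_sub_inv_ne_zero : q - q⁻¹ ≠ 0 := by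
  intro h
  have h1 : q * q = 1 := by
    have h2 : q = q⁻¹ := sub_eq_zero.mp h
    calc q * q = q * q⁻¹ := by rw [← h2]
      _ = 1 := mul_inv_cancel₀ q_ne_zero
  have h3 : algebraMap (Polynomial ℚ) K (Polynomial.X * Polynomial.X) =
      algebraMap (Polynomial ℚ) K 1 := by
    rw [map_mul, map_one, RatFunc.algebraMap_X]; exact h1
  have h4 := congrArg (Polynomial.eval 0) (RatFunc.algebraMap_injective ℚ h3)
  simp at h4

theorem qint_zero : qint 0 = 0 := by simp [qint]

theorem qint_one : qint 1 = 1 := by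
  simp [qint, div_self q_sub_inv_ne_zero]

theorem qint_two : qint 2 = q + q⁻¹ := by
  rw [qint, div_eq_iff q_sub_inv_ne_zero, zpow_neg]
  have h := q_ne_zero
  field_simp
  norm_cast
  ring

theorem opOf_tP {P : Set Mat} (f : Mat → FM P) {A : Mat} (hA : A ∈ P) :
    opOf f (tP P A) = f A := by
  simp [opOf, tP, hA]

theorem BposE_tP {m n : ℕ} {A : Mat} (hA : A ∈ Xij m n n) :
    BposE m n (tP (Xij m n n) A) = ∑ j ∈ II (2 * m + 1),
      (q ^ (∑ k ∈ (II (2 * m + 1)).filter (fun k => j < k), ((A k 1 : ℤ) - (A k 0 : ℤ)))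
        * qint (A j 1)) • tP (Xij m n n) (matMove A j 0 j 1) := by
  have h1 : (1 / 2 + 1 / 2 : ℚ) = 1 := by norm_num
  have h0 : (1 / 2 - 1 / 2 : ℚ) = 0 := by norm_num
  rw [BposE, BRj, opOf_tP _ hA]
  simp only [h1, h0]

theorem BnegE_tP {m n : ℕ} {A : Mat} (hA : A ∈ Xij m n n) :
    BnegE m n (tP (Xij m n n) A) =
      (∑ j ∈ (II (2 * m + 1)).filter (fun j => j ≤ 0),
        if (if j = 0 then 1 else 0) < A j 0 then
          (q ^ (∑ k ∈ (II (2 * m + 1)).filter (fun k => k < j), ((A k 0 : ℤ) - (A k 1 : ℤ)))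
            * qint ((A j 0 : ℤ) - (if j = 0 then 1 else 0)))
            • tP (Xij m n n) (matMove A j 1 j 0)
        else 0)
      + (∑ j ∈ (II (2 * m + 1)).filter (fun j => 0 < j),
          (q ^ ((∑ k ∈ (II (2 * m + 1)).filter (fun k => k < j),
            ((A k 0 : ℤ) - (A k 1 : ℤ))) - 1)
            * qint (A j 0)) • tP (Xij m n n) (matMove A j 1 j 0)) := by
  have h1 : (1 / 2 + 1 / 2 : ℚ) = 1 := by norm_num
  have h0 : (1 / 2 - 1 / 2 : ℚ) = 0 := by norm_num
  rw [BnegE, BRjn, opOf_tP _ hA]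
  simp only [h1, h0, true_and, if_true]

theorem sum_indicator {S T : Finset ℚ} {r c : ℚ} (hr : r ∈ S) (hc : c ∈ T) :
    ∑ x ∈ S, ∑ y ∈ T, (if x = r ∧ y = c then 1 else 0) = 1 := by
  rw [Finset.sum_eq_single r, Finset.sum_eq_single c]
  · simp
  · intro b _ hb; simp [hb]
  · intro h; exact absurd hc h
  · intro b _ hb; simp [hb]
  · intro h; exact absurd hr h

theorem sum_chiM {M N : ℕ} {r c : ℚ} (hr : r ∈ II M) (hc : c ∈ II N) :
    ∑ x ∈ II M, ∑ y ∈ II N, chiM r c x y = 2 := by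
  simp only [chiM, Finset.sum_add_distrib]
  rw [sum_indicator hr hc, sum_indicator (II_neg hr) (II_neg hc)]

theorem chiM_neg_neg (r c x y : ℚ) : chiM r c (-x) (-y) = chiM r c x y := by
  simp only [chiM, neg_eq_iff_eq_neg, neg_neg]
  exact add_comm _ _

theorem mem_II_of_chiM_ne_zero {M N : ℕ} {r c x y : ℚ} (hr : r ∈ II M) (hc : c ∈ II N)
    (h : chiM r c x y ≠ 0) : x ∈ II M ∧ y ∈ II N := by
  unfold chiM at h
  by_cases h1 : x = r ∧ y = c
  · rw [h1.1, h1.2]; exact ⟨hr, hc⟩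
  · by_cases h2 : x = -r ∧ y = -c
    · rw [h2.1, h2.2]; exact ⟨II_neg hr, II_neg hc⟩
    · simp [h1, h2] at h

/-- Column `1` of the matrix is empty and column `0` is `e_0`, so that adding
`E^θ_{a,1}` yields a matrix of `ı`-weight `ρ̄`; rows lie in `{-m,…,m}`. -/
structure HasReducedColumns (m n : ℕ) (R : Mat) : Prop where
  support : ∀ i j, R i j ≠ 0 → i ∈ II (2 * m + 1) ∧ j ∈ II (2 * n + 1)
  symm : ∀ i j, R i j = R (-i) (-j)
  total : ∑ i ∈ II (2 * m + 1), ∑ j ∈ II (2 * n + 1), R i j + 2 = 2 * n + 1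
  col_zero : ∀ x, R x 0 = if x = 0 then 1 else 0
  col_one : ∀ x, R x 1 = 0

namespace HasReducedColumns

variable {m n : ℕ} {R : Mat} {a : ℚ}

theorem add_chiM_mem (h : HasReducedColumns m n R) {c : ℚ} (ha : a ∈ II (2 * m + 1))
    (hc : c ∈ II (2 * n + 1)) : R + chiM a c ∈ Xij m n n := by
  refine ⟨fun i j hij => ?_, fun i j => ?_, ?_⟩
  · by_cases hR : R i j = 0
    · exact mem_II_of_chiM_ne_zero ha hc (by simpa [hR] using hij)
    · exact h.support i j hR
  · simp only [Pi.add_apply, chiM_neg_neg, ← h.symm]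
  · simp only [Pi.add_apply, Finset.sum_add_distrib]
    rw [sum_chiM ha hc]; exact h.total

theorem BposE_add_chiM_one (h : HasReducedColumns m n R) (hn : 1 ≤ n) (ha : a ∈ II (2 * m + 1)) :
    BposE m n (tP (Xij m n n) (R + chiM a 1)) =
      q ^ (if a < 0 then (-1 : ℤ) else 0) • tP (Xij m n n) (R + chiM a 0) := by
  have h0 : ∀ x, (R + chiM a 1) x 0 = if x = 0 then 1 else 0 := by
    intro x; simp [chiM, h.col_zero]
  have h1 : ∀ x, (R + chiM a 1) x 1 = if x = a then 1 else 0 := by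
    intro x
    have : ¬ (1 : ℚ) = -1 := by norm_num
    simp [chiM, h.col_one, this]
  have hmove : matMove (R + chiM a 1) a 0 a 1 = R + chiM a 0 := by
    funext x y; simp only [matMove, Pi.add_apply]; omega
  rw [BposE_tP (h.add_chiM_mem ha (one_mem_II hn)), Finset.sum_eq_single a]
  · have he : (∑ k ∈ (II (2 * m + 1)).filter (fun k => a < k),
        (((R + chiM a 1) k 1 : ℤ) - ((R + chiM a 1) k 0 : ℤ))) = if a < 0 then (-1 : ℤ) else 0 := by
      simp only [h0, h1]
      push_cast
      rw [Finset.sum_sub_distrib, Finset.sum_ite_eq', Finset.sum_ite_eq']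
      by_cases hlt : a < 0 <;> simp [hlt, zero_mem_II]
    rw [he, h1, hmove]
    simp [qint_one]
  · intro b _ hb
    rw [h1]; simp [hb, qint_zero]
  · intro hna; exact absurd ha hna

theorem BposE_add_chiM_zero (h : HasReducedColumns m n R) (ha : a ∈ II (2 * m + 1)) :
    BposE m n (tP (Xij m n n) (R + chiM a 0)) = 0 := by
  rw [BposE_tP (h.add_chiM_mem ha (zero_mem_II n))]
  refine Finset.sum_eq_zero fun j _ => ?_
  simp [chiM, h.col_one, qint_zero]

theorem BnegE_add_chiM_one (h : HasReducedColumns m n R) (hn : 1 ≤ n) (ha : a ∈ II (2 * m + 1)) :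
    BnegE m n (tP (Xij m n n) (R + chiM a 1)) = 0 := by
  have h0 : ∀ x, (R + chiM a 1) x 0 = if x = 0 then 1 else 0 := by
    intro x; simp [chiM, h.col_zero]
  rw [BnegE_tP (h.add_chiM_mem ha (one_mem_II hn)), Finset.sum_eq_zero, Finset.sum_eq_zero,
    add_zero]
  · intro j hj
    rw [h0, if_neg (Finset.mem_filter.mp hj).2.ne']
    simp [qint_zero]
  · intro j _
    rw [h0, if_neg (lt_irrefl _)]

theorem matMove_add_chiM_zero {b : ℚ} (hb : b = a ∨ b = -a) :
    matMove (R + chiM a 0) b 1 b 0 = R + chiM b 1 := by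
  have hab : chiM a 0 = chiM b 0 := by
    rcases hb with rfl | rfl
    · rfl
    · funext x y; simp only [chiM, neg_zero, neg_neg]; exact add_comm _ _
  funext x y; simp only [matMove, Pi.add_apply, hab]; omega

theorem BnegE_add_chiM_zero_of_pos (h : HasReducedColumns m n R) (ha : a ∈ II (2 * m + 1)) (hpos : 0 < a) :
    BnegE m n (tP (Xij m n n) (R + chiM a 0)) =
      tP (Xij m n n) (R + chiM (-a) 1) + q • tP (Xij m n n) (R + chiM a 1) := by
  have h0 : ∀ x, (R + chiM a 0) x 0 =
      (if x = 0 then 1 else 0) + ((if x = a then 1 else 0) + (if x = -a then 1 else 0)) := by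
    intro x; simp [chiM, h.col_zero]
  have h1 : ∀ x, (R + chiM a 0) x 1 = 0 := by
    intro x; simp [chiM, h.col_one]
  have hna := II_neg ha
  have e1 : (R + chiM a 0) (-a) 0 = 1 := by
    rw [h0, if_neg (by linarith), if_neg (by linarith), if_pos rfl]
  have e2 : (R + chiM a 0) a 0 = 1 := by
    rw [h0, if_neg (by linarith), if_pos rfl, if_neg (by linarith)]
  have hs : (∑ k ∈ (II (2 * m + 1)).filter (fun k => k < -a),
      (((R + chiM a 0) k 0 : ℤ) - ((R + chiM a 0) k 1 : ℤ))) = 0 := by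
    refine Finset.sum_eq_zero fun k hk => ?_
    have hk := (Finset.mem_filter.mp hk).2
    rw [h0, h1, if_neg (by linarith), if_neg (by linarith), if_neg hk.ne]
    simp
  have hs' : (∑ k ∈ (II (2 * m + 1)).filter (fun k => k < a),
      (((R + chiM a 0) k 0 : ℤ) - ((R + chiM a 0) k 1 : ℤ))) = 2 := by
    simp only [h0, h1]
    push_cast
    simp only [sub_zero]
    rw [Finset.sum_add_distrib, Finset.sum_add_distrib, Finset.sum_ite_eq', Finset.sum_ite_eq',
      Finset.sum_ite_eq', if_pos, if_neg, if_pos]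
    · norm_num
    · exact Finset.mem_filter.mpr ⟨hna, by linarith⟩
    · simp
    · exact Finset.mem_filter.mpr ⟨zero_mem_II m, hpos⟩
  rw [BnegE_tP (h.add_chiM_mem ha (zero_mem_II n))]
  refine congrArg₂ (· + ·) ((Finset.sum_eq_single (-a) ?_ ?_).trans ?_)
    ((Finset.sum_eq_single a ?_ ?_).trans ?_)
  · intro b hb hba
    have hb := (Finset.mem_filter.mp hb).2
    rw [h0, if_neg hba, if_neg (by linarith : ¬ b = a)]
    simp
  · intro hn; exact absurd (Finset.mem_filter.mpr ⟨hna, by linarith⟩) hn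
  · rw [matMove_add_chiM_zero (Or.inr rfl), hs, e1, if_neg (by linarith : ¬ -a = 0)]
    simp [qint_one, hpos.ne']
  · intro b hb hba
    have hb := (Finset.mem_filter.mp hb).2
    rw [h0, if_neg hb.ne', if_neg hba, if_neg (by linarith)]
    simp [qint_zero]
  · intro hn; exact absurd (Finset.mem_filter.mpr ⟨ha, hpos⟩) hn
  · rw [matMove_add_chiM_zero (Or.inl rfl), hs', e2]
    simp [qint_one]

theorem BnegE_add_chiM_zero_of_zero (h : HasReducedColumns m n R) :
    BnegE m n (tP (Xij m n n) (R + chiM 0 0)) =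
      (q + q⁻¹) • tP (Xij m n n) (R + chiM 0 1) := by
  have h0 : ∀ x, (R + chiM 0 0) x 0 = if x = 0 then 3 else 0 := by
    intro x
    by_cases hx : x = 0 <;> simp [chiM, h.col_zero, hx]
  have h1 : ∀ x, (R + chiM 0 0) x 1 = 0 := by
    intro x; simp [chiM, h.col_one]
  have hs : (∑ k ∈ (II (2 * m + 1)).filter (fun k => k < 0),
      (((R + chiM 0 0) k 0 : ℤ) - ((R + chiM 0 0) k 1 : ℤ))) = 0 := by
    refine Finset.sum_eq_zero fun k hk => ?_
    have hk := (Finset.mem_filter.mp hk).2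
    rw [h0, h1, if_neg hk.ne]
    simp
  rw [BnegE_tP (h.add_chiM_mem (zero_mem_II m) (zero_mem_II n))]
  refine (congrArg₂ (· + ·) (Finset.sum_eq_single 0 ?_ ?_) (Finset.sum_eq_zero ?_)).trans ?_
  · intro b _ hb
    rw [if_neg]
    rw [h0, if_neg hb, if_neg hb]
    exact lt_irrefl 0
  · intro hn
    simp [zero_mem_II] at hn
  · intro b hb
    have hb := (Finset.mem_filter.mp hb).2
    rw [h0, if_neg hb.ne']
    simp [qint_zero]
  · rw [matMove_add_chiM_zero (Or.inl rfl), hs, h0]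
    norm_num [qint_two]

theorem Cop_of_ne_zero (h : HasReducedColumns m n R) (hn : 1 ≤ n) (ha : a ∈ II (2 * m + 1)) (h0 : a ≠ 0) :
    Cop m n (tP (Xij m n n) (R + chiM a 1)) =
      tP (Xij m n n) (R + chiM (-a) 1)
        + q ^ (if 0 < a then (1 : ℤ) else -1) • tP (Xij m n n) (R + chiM a 1) := by
  rw [Cop, Module.End.mul_apply, h.BposE_add_chiM_one hn ha, map_smul]
  rcases lt_or_gt_of_ne h0 with hlt | hgt
  · have hsymm : chiM a 0 = chiM (-a) 0 := by
      funext x y; simp only [chiM, neg_zero, neg_neg]; exact add_comm _ _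
    rw [hsymm, h.BnegE_add_chiM_zero_of_pos (II_neg ha) (by linarith), if_pos hlt,
      if_neg (by linarith), neg_neg, smul_add, smul_smul, zpow_neg_one,
      inv_mul_cancel₀ q_ne_zero, one_smul, add_comm]
  · rw [h.BnegE_add_chiM_zero_of_pos ha hgt, if_neg (by linarith), if_pos hgt, zpow_zero,
      one_smul, zpow_one]

theorem Cop_of_zero (h : HasReducedColumns m n R) (hn : 1 ≤ n) :
    Cop m n (tP (Xij m n n) (R + chiM 0 1)) = (q + q⁻¹) • tP (Xij m n n) (R + chiM 0 1) := by
  rw [Cop, Module.End.mul_apply, h.BposE_add_chiM_one hn (zero_mem_II m), map_smul,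
    h.BnegE_add_chiM_zero_of_zero]
  simp

end HasReducedColumns

theorem Aj_term_eq_chiM {n : ℕ} (l : Fin n → ℚ) (j : Fin n) (x y : ℚ) :
    ((if y = (j : ℚ) + 1 ∧ x = l j then 1 else 0)
      + (if y = -((j : ℚ) + 1) ∧ x = -(l j) then 1 else 0)) = chiM (l j) ((j : ℚ) + 1) x y := by
  simp only [chiM, and_comm]

theorem Aj_eq_sum_chiM {n : ℕ} (l : Fin n → ℚ) (x y : ℚ) :
    Aj l x y = (if x = 0 ∧ y = 0 then 1 else 0) + ∑ j : Fin n, chiM (l j) ((j : ℚ) + 1) x y := by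
  simp only [Aj, Aj_term_eq_chiM]

/-- The matrix `A_λ` with its columns `±1` emptied. -/
def AjTail {n : ℕ} (hn : 0 < n) (l : Fin n → ℚ) : Mat := fun x y =>
  (if x = 0 ∧ y = 0 then 1 else 0)
    + ∑ j ∈ Finset.univ.erase (⟨0, hn⟩ : Fin n), chiM (l j) ((j : ℚ) + 1) x y

theorem Aj_eq_tail_add {n : ℕ} (hn : 0 < n) (l : Fin n → ℚ) :
    Aj l = AjTail hn l + chiM (l ⟨0, hn⟩) 1 := by
  funext x y
  rw [Aj_eq_sum_chiM, ← Finset.add_sum_erase _ _ (Finset.mem_univ (⟨0, hn⟩ : Fin n))]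
  simp only [Pi.add_apply, AjTail, Nat.cast_zero, zero_add]
  ring

theorem AjTail_update {n : ℕ} (hn : 0 < n) (l : Fin n → ℚ) (b : ℚ) :
    AjTail hn (Function.update l ⟨0, hn⟩ b) = AjTail hn l := by
  funext x y
  simp only [AjTail]
  congr 1
  refine Finset.sum_congr rfl fun j hj => ?_
  rw [Function.update_of_ne (Finset.ne_of_mem_erase hj)]

theorem chiM_col_zero (r : ℚ) (k : ℕ) (x : ℚ) : chiM r ((k : ℚ) + 1) x 0 = 0 := by
  have h1 : (0 : ℚ) ≠ (k : ℚ) + 1 := by positivity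
  have h2 : (0 : ℚ) ≠ -((k : ℚ) + 1) := by
    intro h; apply h1; linarith
  simp only [chiM, h1, h2, and_false, if_false]

theorem chiM_col_succ (r : ℚ) (j k : ℕ) (x : ℚ) :
    chiM r ((j : ℚ) + 1) x ((k : ℚ) + 1) = if k = j ∧ x = r then 1 else 0 := by
  have h2 : ((k : ℚ) + 1) ≠ -((j : ℚ) + 1) := by
    have hk : (0 : ℚ) ≤ k := by positivity
    have hj : (0 : ℚ) ≤ j := by positivity
    intro h; linarith
  simp only [chiM, h2, and_false, if_false, add_zero, add_left_inj, Nat.cast_inj]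
  simp only [and_comm]

theorem hasReducedColumns_AjTail {m n : ℕ} (hn : 0 < n) {l : Fin n → ℚ} (hl : ∀ j, l j ∈ II (2 * m + 1)) :
    HasReducedColumns m n (AjTail hn l) where
  support i j hij := by
    by_cases h0 : i = 0 ∧ j = 0
    · rw [h0.1, h0.2]; exact ⟨zero_mem_II m, zero_mem_II n⟩
    · rw [AjTail, if_neg h0, zero_add] at hij
      obtain ⟨k, _, hk⟩ := Finset.exists_ne_zero_of_sum_ne_zero hij
      exact mem_II_of_chiM_ne_zero (hl k) (succ_mem_II k) hk
  symm i j := by simp only [AjTail, chiM_neg_neg, neg_eq_zero]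
  total := by
    have hc : ∀ x, ∑ y ∈ II (2 * n + 1), ∑ j ∈ Finset.univ.erase (⟨0, hn⟩ : Fin n),
        chiM (l j) ((j : ℚ) + 1) x y = ∑ j ∈ Finset.univ.erase (⟨0, hn⟩ : Fin n),
        ∑ y ∈ II (2 * n + 1), chiM (l j) ((j : ℚ) + 1) x y := fun x => Finset.sum_comm
    simp only [AjTail, Finset.sum_add_distrib, hc]
    rw [sum_indicator (zero_mem_II m) (zero_mem_II n), Finset.sum_comm,
      Finset.sum_congr rfl fun j _ => sum_chiM (hl j) (succ_mem_II j), Finset.sum_const,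
      Finset.card_erase_of_mem (Finset.mem_univ _), Finset.card_univ, Fintype.card_fin, smul_eq_mul]
    omega
  col_zero x := by simp [AjTail, chiM_col_zero]
  col_one x := by
    have h1 : (1 : ℚ) = ((0 : ℕ) : ℚ) + 1 := by simp
    rw [AjTail, if_neg (by simp), zero_add]
    refine Finset.sum_eq_zero fun j hj => ?_
    have hne : ¬ (0 = (j : ℕ) ∧ x = l j) :=
      fun h => Finset.ne_of_mem_erase hj (Fin.ext h.1.symm)
    exact (congrArg (chiM (l j) ((j : ℚ) + 1) x) h1).trans
      ((chiM_col_succ (l j) j 0 x).trans (if_neg hne))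

theorem Aj_mem_Xij {m n : ℕ} (hn : 0 < n) {l : Fin n → ℚ} (hl : ∀ j, l j ∈ II (2 * m + 1)) :
    Aj l ∈ Xij m n n := by
  rw [Aj_eq_tail_add hn]
  exact (hasReducedColumns_AjTail hn hl).add_chiM_mem (hl _) (one_mem_II hn)

theorem Aj_col_zero {n : ℕ} (l : Fin n → ℚ) (x : ℚ) : Aj l x 0 = if x = 0 then 1 else 0 := by
  simp [Aj_eq_sum_chiM, chiM_col_zero]

theorem Aj_col_succ {n : ℕ} (l : Fin n → ℚ) (x : ℚ) (k : Fin n) :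
    Aj l x ((k : ℚ) + 1) = if x = l k then 1 else 0 := by
  have h1 : ((k : ℕ) : ℚ) + 1 ≠ 0 := by positivity
  rw [Aj_eq_sum_chiM, if_neg (fun h => h1 h.2), zero_add, Finset.sum_eq_single k]
  · simp [chiM_col_succ]
  · intro b _ hb
    rw [chiM_col_succ, if_neg]
    rintro ⟨h, -⟩
    exact hb (Fin.ext h.symm)
  · simp

theorem Aj_mem_Xi0j {m n : ℕ} (hn : 0 < n) {l : Fin n → ℚ} (hl : ∀ j, l j ∈ II (2 * m + 1)) :
    Aj l ∈ Xi0j m n := by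
  refine ⟨Aj_mem_Xij hn hl, by simp [Aj_col_zero], fun j hj => ?_⟩
  obtain ⟨hj, hpos⟩ := Finset.mem_filter.mp hj
  rcases eq_of_mem_II hj with rfl | ⟨k, rfl | rfl⟩
  · exact absurd hpos (lt_irrefl _)
  · simp [Aj_col_succ, hl]
  · have : (0 : ℚ) ≤ (k : ℕ) := by positivity
    linarith

theorem exists_eq_one_of_sum_eq_one {S : Finset ℚ} {f : ℚ → ℕ} (h : ∑ x ∈ S, f x = 1) :
    ∃ x ∈ S, f x = 1 := by
  obtain ⟨x, hx, hne⟩ := Finset.exists_ne_zero_of_sum_ne_zero (h.trans_ne one_ne_zero)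
  have := Finset.single_le_sum (f := f) (fun _ _ => Nat.zero_le _) hx
  exact ⟨x, hx, by omega⟩

theorem exists_eq_Aj {m n : ℕ} (hn : 0 < n) {A : Mat} (hA : A ∈ Xi0j m n) :
    ∃ l : Fin n → SubI (2 * m + 1), A = Aj fun j => (l j).1 := by
  obtain ⟨⟨hsupp, hsymm, htot⟩, h00, hcol⟩ := hA
  have hex : ∀ j : Fin n, ∃ x ∈ II (2 * m + 1), A x ((j : ℚ) + 1) = 1 := fun j =>
    exists_eq_one_of_sum_eq_one (hcol _ (Finset.mem_filter.mpr ⟨succ_mem_II j, by positivity⟩))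
  choose r hr hr1 using hex
  refine ⟨fun j => ⟨r j, hr j⟩, ?_⟩
  obtain ⟨hsupp', hsymm', htot'⟩ := Aj_mem_Xij hn hr
  have hsucc : ∀ x (k : Fin n), Aj r x ((k : ℚ) + 1) ≤ A x ((k : ℚ) + 1) := by
    intro x k
    rw [Aj_col_succ]
    split_ifs with hx
    · rw [hx, hr1]
    · exact Nat.zero_le _
  have hle : ∀ x, ∀ y ∈ II (2 * n + 1), Aj r x y ≤ A x y := by
    intro x y hy
    rcases eq_of_mem_II hy with rfl | ⟨k, rfl | rfl⟩
    · rw [Aj_col_zero]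
      split_ifs with hx
      · rw [hx, h00]
      · exact Nat.zero_le _
    · exact hsucc x k
    · rw [hsymm, hsymm', neg_neg]
      exact hsucc (-x) k
  have hrow := (Finset.sum_eq_sum_iff_of_le fun x _ => Finset.sum_le_sum (hle x)).mp
    (htot'.trans htot.symm)
  funext x y
  by_cases hxy : x ∈ II (2 * m + 1) ∧ y ∈ II (2 * n + 1)
  · exact ((Finset.sum_eq_sum_iff_of_le (hle x)).mp (hrow x hxy.1) y hxy.2).symm
  · rw [not_imp_comm.mp (hsupp x y) hxy]
    exact (not_imp_comm.mp (hsupp' x y) hxy).symm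

theorem Lamj_tT (m n : ℕ) (l : Fin n → SubI (2 * m + 1)) :
    Lamj m n (tT l) = tP (Xij m n n) (Aj fun r => (l r).1) := by
  simp [Lamj, tT]

theorem Lamj_tT_eq_tail {m n : ℕ} (hn : 0 < n) (l : Fin n → SubI (2 * m + 1)) :
    Lamj m n (tT l) =
      tP (Xij m n n) (AjTail hn (fun r => (l r).1) + chiM (l ⟨0, hn⟩).1 1) := by
  rw [Lamj_tT, Aj_eq_tail_add hn]

theorem Lamj_tT_update {m n : ℕ} (hn : 0 < n) (l : Fin n → SubI (2 * m + 1))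
    (b : SubI (2 * m + 1)) :
    Lamj m n (tT (Function.update l ⟨0, hn⟩ b)) =
      tP (Xij m n n) (AjTail hn (fun r => (l r).1) + chiM b.1 1) := by
  have h : (fun r => (Function.update l ⟨0, hn⟩ b r).1) =
      Function.update (fun r => (l r).1) ⟨0, hn⟩ b.1 := by
    funext r
    by_cases hr : r = ⟨0, hn⟩
    · subst hr; simp
    · simp [Function.update_of_ne hr]
  rw [Lamj_tT_eq_tail hn, h, AjTail_update, Function.update_self]

theorem Cop_Lamj_of_ne_zero {m n : ℕ} (hn : 0 < n) (l : Fin n → SubI (2 * m + 1))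
    (h : (l ⟨0, hn⟩).1 ≠ 0) :
    Cop m n (Lamj m n (tT l)) =
      Lamj m n (tT (Function.update l ⟨0, hn⟩ (negS (l ⟨0, hn⟩))))
        + (q ^ (if 0 < (l ⟨0, hn⟩).1 then (1 : ℤ) else -1)) • Lamj m n (tT l) := by
  rw [Lamj_tT_update, Lamj_tT_eq_tail hn]
  exact (hasReducedColumns_AjTail hn fun r => (l r).2).Cop_of_ne_zero hn (l _).2 h

theorem Cop_Lamj_of_zero {m n : ℕ} (hn : 0 < n) (l : Fin n → SubI (2 * m + 1))
    (h : (l ⟨0, hn⟩).1 = 0) :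
    Cop m n (Lamj m n (tT l)) = (q + q⁻¹) • Lamj m n (tT l) := by
  rw [Lamj_tT_eq_tail hn, h]
  exact (hasReducedColumns_AjTail hn fun r => (l r).2).Cop_of_zero hn

theorem V0j_eq_span_Lamj {m n : ℕ} (hn : 0 < n) :
    V0j m n = Submodule.span K (Set.range fun l => Lamj m n (tT l)) := by
  rw [V0j]
  congr 1
  ext v
  constructor
  · rintro ⟨A, hA, rfl⟩
    obtain ⟨l, rfl⟩ := exists_eq_Aj hn hA
    exact ⟨l, Lamj_tT m n l⟩
  · rintro ⟨l, rfl⟩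
    exact ⟨_, Aj_mem_Xi0j hn fun r => (l r).2, Lamj_tT m n l⟩

theorem Lamj_mem_V0j {m n : ℕ} (hn : 0 < n) (l : Fin n → SubI (2 * m + 1)) :
    Lamj m n (tT l) ∈ V0j m n := by
  rw [V0j_eq_span_Lamj hn]
  exact Submodule.subset_span ⟨l, rfl⟩

/-- Two endomorphisms agree on `𝒱^{ȷ,0}` as soon as they agree on the vectors `Λ^ȷ(v_λ)`. -/
theorem eqOn_V0j {m n : ℕ} (hn : 0 < n) {f g : Module.End K (FM (Xij m n n))}
    (h : ∀ l, f (Lamj m n (tT l)) = g (Lamj m n (tT l))) {v : FM (Xij m n n)} (hv : v ∈ V0j m n) :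
    f v = g v := by
  rw [V0j_eq_span_Lamj hn] at hv
  refine LinearMap.eqOn_span ?_ hv
  rintro _ ⟨l, rfl⟩
  exact h l

theorem BnegE_Lamj {m n : ℕ} (hn : 0 < n) (l : Fin n → SubI (2 * m + 1)) :
    BnegE m n (Lamj m n (tT l)) = 0 := by
  rw [Lamj_tT_eq_tail hn]
  exact (hasReducedColumns_AjTail hn fun r => (l r).2).BnegE_add_chiM_one hn (l _).2

theorem BposE_BposE_Lamj {m n : ℕ} (hn : 0 < n) (l : Fin n → SubI (2 * m + 1)) :
    BposE m n (BposE m n (Lamj m n (tT l))) = 0 := by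
  have h := hasReducedColumns_AjTail (m := m) hn fun r => (l r).2
  rw [Lamj_tT_eq_tail hn, h.BposE_add_chiM_one hn (l _).2, map_smul,
    h.BposE_add_chiM_zero (l _).2, smul_zero]

theorem single_eq_Lamj {m n : ℕ} (hn : 0 < n) (A : {A : Mat // A ∈ Xij m n n})
    (hA : A.1 ∈ Xi0j m n) : ∃ l, (Finsupp.single A 1 : FM (Xij m n n)) = Lamj m n (tT l) := by
  obtain ⟨A, hP⟩ := A
  obtain ⟨l, rfl⟩ := exists_eq_Aj hn hA
  exact ⟨l, by rw [Lamj_tT, tP, dif_pos hP]⟩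

theorem Cop_mem_V0j {m n : ℕ} (hn : 0 < n) {v : FM (Xij m n n)} (hv : v ∈ V0j m n) :
    Cop m n v ∈ V0j m n := by
  have hle : V0j m n ≤ (V0j m n).comap (Cop m n) := by
    conv_lhs => rw [V0j_eq_span_Lamj hn]
    rw [Submodule.span_le]
    rintro _ ⟨l, rfl⟩
    change Cop m n (Lamj m n (tT l)) ∈ V0j m n
    by_cases h : (l ⟨0, hn⟩).1 = 0
    · rw [Cop_Lamj_of_zero hn l h]
      exact Submodule.smul_mem _ _ (Lamj_mem_V0j hn l)
    · rw [Cop_Lamj_of_ne_zero hn l h]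
      exact Submodule.add_mem _ (Lamj_mem_V0j hn _)
        (Submodule.smul_mem _ _ (Lamj_mem_V0j hn l))
  exact hle hv

theorem Cop_Cop_Lamj {m n : ℕ} (hn : 0 < n) (l : Fin n → SubI (2 * m + 1)) :
    Cop m n (Cop m n (Lamj m n (tT l))) = (q + q⁻¹) • Cop m n (Lamj m n (tT l)) := by
  by_cases h : (l ⟨0, hn⟩).1 = 0
  · rw [Cop_Lamj_of_zero hn l h, map_smul, Cop_Lamj_of_zero hn l h]
  · set l' := Function.update l ⟨0, hn⟩ (negS (l ⟨0, hn⟩)) with hl'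
    have h0 : (l' ⟨0, hn⟩).1 = -(l ⟨0, hn⟩).1 := by
      rw [hl', Function.update_self]; rfl
    have hback : Function.update l' ⟨0, hn⟩ (negS (l' ⟨0, hn⟩)) = l := by
      have hneg : negS (l' ⟨0, hn⟩) = l ⟨0, hn⟩ := Subtype.ext (by simp [negS, h0])
      rw [hneg, hl', Function.update_idem, Function.update_eq_self]
    have hC := Cop_Lamj_of_ne_zero hn l h
    have hC' := Cop_Lamj_of_ne_zero hn l' (by rw [h0]; exact neg_ne_zero.mpr h)
    rw [hback, h0] at hC'
    rw [← hl'] at hC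
    rcases lt_or_gt_of_ne h with hlt | hgt
    · rw [if_neg (by linarith)] at hC
      rw [if_pos (by linarith)] at hC'
      simp only [hC, map_add, map_smul, hC', zpow_neg_one, zpow_one]
      exact smul_add_smul_swap q_ne_zero _ _
    · rw [if_pos hgt] at hC
      rw [if_neg (by linarith)] at hC'
      simp only [hC, map_add, map_smul, hC', zpow_neg_one, zpow_one]
      simpa only [inv_inv, add_comm q⁻¹ q] using smul_add_smul_swap (inv_ne_zero q_ne_zero) _ _

theorem jterm_Lamj_of_pos {m n t : ℕ} (hn : 0 < n) (ht : t ≠ 0) (k : ℕ)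
    (l : Fin n → SubI (2 * m + 1)) : jterm m n t k (Lamj m n (tT l)) = 0 := by
  obtain ⟨t, rfl⟩ := Nat.exists_eq_succ_of_ne_zero ht
  rw [jterm, LinearMap.smul_apply, pow_succ (BnegE m n) t, Module.End.mul_apply,
    Module.End.mul_apply, Module.End.mul_apply, BnegE_Lamj hn]
  simp

theorem jterm_zero_Lamj_of_two_le {m n k : ℕ} (hn : 0 < n) (hk : 2 ≤ k)
    (l : Fin n → SubI (2 * m + 1)) : jterm m n 0 k (Lamj m n (tT l)) = 0 := by
  obtain ⟨k, rfl⟩ := Nat.exists_eq_add_of_le' hk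
  rw [jterm, LinearMap.smul_apply, zero_add, pow_zero, mul_one, pow_add (BposE m n) k 2, sq,
    Module.End.mul_apply, Module.End.mul_apply, Module.End.mul_apply, BposE_BposE_Lamj hn]
  simp

theorem sum_jterm_Lamj {m n N : ℕ} (hn : 0 < n) (hN : 2 ≤ N) (l : Fin n → SubI (2 * m + 1)) :
    (∑ t ∈ Finset.range N, ∑ k ∈ Finset.range N, jcoef t k • jterm m n t k) (Lamj m n (tT l)) =
      T0j m n (Lamj m n (tT l)) := by
  simp only [LinearMap.sum_apply, LinearMap.smul_apply]
  rw [Finset.sum_eq_single 0]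
  · obtain ⟨N, rfl⟩ := Nat.exists_eq_add_of_le' hN
    rw [Finset.sum_range_succ', Finset.sum_range_succ', Finset.sum_eq_zero]
    · simp [jcoef, jterm, qfac, qint_one, T0j, Cop]
      abel
    · intro k _
      rw [jterm_zero_Lamj_of_two_le hn (by omega), smul_zero]
  · intro t _ ht
    refine Finset.sum_eq_zero fun k _ => ?_
    rw [jterm_Lamj_of_pos hn ht, smul_zero]
  · intro h
    exact absurd (Finset.mem_range.mpr (by omega)) h

theorem T0j_apply (m n : ℕ) (v : FM (Xij m n n)) : T0j m n v = v - q⁻¹ • Cop m n v := rfl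

theorem neg_q_smul_T0j_Lamj {m n : ℕ} (hn : 0 < n) (l : Fin n → SubI (2 * m + 1)) :
    (-q) • T0j m n (Lamj m n (tT l)) = Lamj m n (sigma0 hn (tT l)) := by
  have hs : sigma0 hn (tT l) =
      if 0 < (l ⟨0, hn⟩).1 then tT (Function.update l ⟨0, hn⟩ (negS (l ⟨0, hn⟩)))
      else if (l ⟨0, hn⟩).1 = 0 then q⁻¹ • tT l
      else tT (Function.update l ⟨0, hn⟩ (negS (l ⟨0, hn⟩))) + (q⁻¹ - q) • tT l := by
    refine (Finsupp.sum_single_index ?_).trans ?_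
    · exact zero_smul K _
    · exact one_smul K _
  rw [hs, T0j_apply, neg_smul_sub_inv_smul q_ne_zero]
  rcases lt_trichotomy (l ⟨0, hn⟩).1 0 with h | h | h
  · rw [Cop_Lamj_of_ne_zero hn l h.ne, if_neg h.not_gt, if_neg h.not_gt, if_neg h.ne, zpow_neg_one,
      map_add, map_smul, sub_smul, add_sub_assoc]
  · rw [Cop_Lamj_of_zero hn l h, if_neg h.not_gt, if_pos h, map_smul, add_smul, add_sub_cancel_left]
  · rw [Cop_Lamj_of_ne_zero hn l h.ne', if_pos h, if_pos h, zpow_one, add_sub_cancel_right]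

theorem hecke_relation_Lamj {m n : ℕ} (hn : 0 < n) (l : Fin n → SubI (2 * m + 1)) :
    ((T0j m n + (q ^ (-2 : ℤ)) • 1) * (T0j m n - 1)) (Lamj m n (tT l)) = 0 :=
  hecke_relation_of_quadratic q_ne_zero _ (Cop_Cop_Lamj hn l)

theorem stmt4 (m n : ℕ) (hm : 1 ≤ m) (hn : 1 ≤ n) :
    -- (1) t^{(A)} B^R_{-1/2} = 0 for A ∈ Ξ^{ȷ,0}
    (∀ A : {A : Mat // A ∈ Xij m n n}, A.1 ∈ Xi0j m n →
        BnegE m n (Finsupp.single A 1) = 0) ∧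
    -- (2) t^{(A)} B^R_{1/2} B^R_{1/2} = 0 for A ∈ Ξ^{ȷ,0}
    (∀ A : {A : Mat // A ∈ Xij m n n}, A.1 ∈ Xi0j m n →
        BposE m n (BposE m n (Finsupp.single A 1)) = 0) ∧
    -- (3) C preserves 𝒱^{ȷ,0}, with explicit formulas on the basis
    (∀ v ∈ V0j m n, Cop m n v ∈ V0j m n) ∧
    (∀ l : Fin n → SubI (2*m+1), (l ⟨0, hn⟩).1 ≠ 0 →
        Cop m n (Lamj m n (tT l))
          = Lamj m n (tT (Function.update l ⟨0, hn⟩ (negS (l ⟨0, hn⟩))))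
            + (q ^ (if 0 < (l ⟨0, hn⟩).1 then (1 : ℤ) else -1)) • Lamj m n (tT l)) ∧
    (∀ l : Fin n → SubI (2*m+1), (l ⟨0, hn⟩).1 = 0 →
        Cop m n (Lamj m n (tT l)) = (q + q⁻¹) • Lamj m n (tT l)) ∧
    -- (4) the ı-divided power sum is finite on 𝒱^{ȷ,0} and equals T_0 = id - q⁻¹ C
    (∀ N : ℕ, 2 ≤ N → ∀ v ∈ V0j m n,
        (∑ t ∈ Finset.range N, ∑ l ∈ Finset.range N, jcoef t l • jterm m n t l) v
          = T0j m n v) ∧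
    -- (5) -q·T_0 corresponds to σ_0 under Λ^ȷ
    (∀ l : Fin n → SubI (2*m+1),
        (-q) • T0j m n (Lamj m n (tT l)) = Lamj m n (sigma0 hn (tT l))) ∧
    -- (6) the Hecke relation on 𝒱^{ȷ,0}
    (∀ v ∈ V0j m n, ((T0j m n + (q ^ (-2 : ℤ)) • 1) * (T0j m n - 1)) v = 0) := by
  refine ⟨fun A hA => ?_, fun A hA => ?_, fun v hv => Cop_mem_V0j hn hv,
    fun l h => Cop_Lamj_of_ne_zero hn l h, fun l h => Cop_Lamj_of_zero hn l h,
    fun N hN v hv => eqOn_V0j hn (fun l => sum_jterm_Lamj hn hN l) hv,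
    fun l => neg_q_smul_T0j_Lamj hn l,
    fun v hv => eqOn_V0j (g := 0) hn (fun l => hecke_relation_Lamj hn l) hv⟩
  · obtain ⟨l, hl⟩ := single_eq_Lamj hn A hA
    rw [hl, BnegE_Lamj hn]
  · obtain ⟨l, hl⟩ := single_eq_Lamj hn A hA
    rw [hl, BposE_BposE_Lamj hn]

end
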